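/- Let U be a linear subspace of m×m complex matrices and suppose there exists a nonzero vector u ∈ ℂ^m with uᵀ A = 0 for every A ∈ U. Then for any X, Y, Z ∈ U one has X·adj(Y)·Z − Z·adj(Y)·X = 0. -/

import Mathlib

open Matrix

theorem adjugate_mul_eq_zero_aux {m : ℕ} (u : Fin m → ℂ) (hu : u ≠ 0)
    (Y Z : Matrix (Fin m) (Fin m) ℂ) (hY : vecMul u Y = 0) (hZ : vecMul u Z = 0) :
    adjugate Y * Z = 0 := by
  ext i j
  have h1 : (adjugate Y * Z) i j = (Y.updateCol i (fun k => Z k j)).det := by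
    rw [← cramer_apply, cramer_eq_adjugate_mulVec]
    rfl
  rw [h1, Matrix.zero_apply]
  apply Matrix.exists_vecMul_eq_zero_iff.mp
  refine ⟨u, hu, ?_⟩
  ext k
  by_cases hk : k = i
  · subst hk
    have := congrFun hZ j
    simpa [vecMul, dotProduct] using this
  · have := congrFun hY k
    simpa [vecMul, dotProduct, hk] using this

theorem stmt5 {m : ℕ} (U : Submodule ℂ (Matrix (Fin m) (Fin m) ℂ))
    (u : Fin m → ℂ) (hu : u ≠ 0) (hU : ∀ A ∈ U, vecMul u A = 0)
    (X Y Z : Matrix (Fin m) (Fin m) ℂ) (hX : X ∈ U) (hY : Y ∈ U) (hZ : Z ∈ U) :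
    X * adjugate Y * Z - Z * adjugate Y * X = 0 := by
  rw [Matrix.mul_assoc, Matrix.mul_assoc,
    adjugate_mul_eq_zero_aux u hu Y Z (hU Y hY) (hU Z hZ),
    adjugate_mul_eq_zero_aux u hu Y X (hU Y hY) (hU X hX)]
  simp
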